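/- Conservation of the separation constant in the Euler two-center problem: if I ⊆ ℝ is an open interval and q, p : I → ℝ³ are differentiable functions such that for every t ∈ I one has q(t) ∉ {o₁, o₂}, q'(t) = p(t), and p'(t) = −∇V(q(t)), then the function t ↦ G(q(t), p(t)) is constant on I. In particular G is a first integral of the Euler problem. -/

import Mathlib

noncomputable section

open Real Filter Topology
open scoped RealInnerProductSpace

/-- Euclidean 3-space. -/
abbrev R3 : Type := EuclideanSpace ℝ (Fin 3)

/-- The vector `(x, y, z)` in `R3`. -/
def vec3 (x y z : ℝ) : R3 := (WithLp.equiv 2 (Fin 3 → ℝ)).symm ![x, y, z]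

/-- The first center `o₁ = (0,0,-a)`. -/
def ctr1 (a : ℝ) : R3 := vec3 0 0 (-a)

/-- The second center `o₂ = (0,0,a)`. -/
def ctr2 (a : ℝ) : R3 := vec3 0 0 a

/-- The Euler two-center potential `V(q) = -μ₁/r₁(q) - μ₂/r₂(q)`. -/
def eulerV (a μ1 μ2 : ℝ) (q : R3) : ℝ := -μ1 / ‖q - ctr1 a‖ - μ2 / ‖q - ctr2 a‖

/-- The angular momentum `L_z(q,p) = x p_y - y p_x`. -/
def angMom (q p : R3) : ℝ := q 0 * p 1 - q 1 * p 0

/-- The cross product `q × p` in `R3`. -/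
def cross3 (q p : R3) : R3 :=
  vec3 (q 1 * p 2 - q 2 * p 1) (q 2 * p 0 - q 0 * p 2) (q 0 * p 1 - q 1 * p 0)

/-- The Euler Hamiltonian `H(q,p) = ‖p‖²/2 + V(q)`. -/
def eulerH (a μ1 μ2 : ℝ) (q p : R3) : ℝ := ‖p‖ ^ 2 / 2 + eulerV a μ1 μ2 q

/-- The separation constant
`G(q,p) = H + (‖q×p‖² - a²(pₓ²+p_y²))/2 + a(z+a)μ₁/r₁ - a(z-a)μ₂/r₂`. -/
def eulerG (a μ1 μ2 : ℝ) (q p : R3) : ℝ :=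
  eulerH a μ1 μ2 q p + (‖cross3 q p‖ ^ 2 - a ^ 2 * ((p 0) ^ 2 + (p 1) ^ 2)) / 2
    + a * (q 2 + a) * μ1 / ‖q - ctr1 a‖ - a * (q 2 - a) * μ2 / ‖q - ctr2 a‖

lemma hasFDerivAt_invnorm (c x : R3) (h : x ≠ c) :
    HasFDerivAt (fun y : R3 => ‖y - c‖⁻¹) (-(‖x - c‖ ^ 3)⁻¹ • innerSL ℝ (x - c)) x := by
  have hne : ‖x - c‖ ≠ 0 := norm_ne_zero_iff.2 (sub_ne_zero.2 h)
  have h1 : HasFDerivAt (fun y : R3 => y - c) (ContinuousLinearMap.id ℝ R3) x :=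
    (hasFDerivAt_id x).sub_const c
  have h2 := h1.norm_sq
  have h3 := h2.sqrt (pow_ne_zero 2 hne)
  have e : (fun y : R3 => √(‖y - c‖ ^ 2)) = fun y => ‖y - c‖ := by
    funext y; exact Real.sqrt_sq (norm_nonneg _)
  rw [e, Real.sqrt_sq (norm_nonneg _)] at h3
  have h4 := (hasDerivAt_inv hne).comp_hasFDerivAt x h3
  refine h4.congr_fderiv ?_
  ext v
  simp
  field_simp

lemma gradV (a μ1 μ2 : ℝ) (x : R3) (h1 : x ≠ ctr1 a) (h2 : x ≠ ctr2 a) :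
    gradient (eulerV a μ1 μ2) x =
      (μ1 * (‖x - ctr1 a‖ ^ 3)⁻¹) • (x - ctr1 a) + (μ2 * (‖x - ctr2 a‖ ^ 3)⁻¹) • (x - ctr2 a) := by
  apply HasGradientAt.gradient
  rw [hasGradientAt_iff_hasFDerivAt]
  have := ((hasFDerivAt_invnorm _ x h1).const_mul (-μ1)).sub
    ((hasFDerivAt_invnorm _ x h2).const_mul μ2)
  refine this.congr_fderiv ?_
  ext v
  simp [inner_add_left, inner_smul_left]
  ring

lemma nsq (x : R3) : ‖x‖ ^ 2 = x 0 ^ 2 + x 1 ^ 2 + x 2 ^ 2 := by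
  rw [EuclideanSpace.norm_sq_eq]; simp [Fin.sum_univ_three]

@[simp] lemma vec3_0 (x y z : ℝ) : vec3 x y z 0 = x := rfl
@[simp] lemma vec3_1 (x y z : ℝ) : vec3 x y z 1 = y := rfl
@[simp] lemma vec3_2 (x y z : ℝ) : vec3 x y z 2 = z := rfl

lemma curve_inv (q : ℝ → R3) (v c : R3) (t : ℝ) (hq : HasDerivAt q v t) (h : q t ≠ c) :
    HasDerivAt (fun s => ‖q s - c‖⁻¹) (-(‖q t - c‖ ^ 3)⁻¹ *
      ((q t 0 - c 0) * v 0 + (q t 1 - c 1) * v 1 + (q t 2 - c 2) * v 2)) t := by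
  have := (hasFDerivAt_invnorm c (q t) h).comp_hasDerivAt t hq
  refine this.congr_deriv ?_
  simp [PiLp.inner_apply, Fin.sum_univ_three]
  left
  ring

lemma coordD (q : ℝ → R3) (v : R3) (t : ℝ) (hq : HasDerivAt q v t) (i : Fin 3) :
    HasDerivAt (fun s => q s i) (v i) t :=
  (EuclideanSpace.proj i : R3 →L[ℝ] ℝ).hasFDerivAt.comp_hasDerivAt t hq

lemma G_eq (a μ1 μ2 : ℝ) (q p : R3) : eulerG a μ1 μ2 q p =
    (p 0 ^ 2 + p 1 ^ 2 + p 2 ^ 2) / 2 + (-μ1 * ‖q - ctr1 a‖⁻¹ - μ2 * ‖q - ctr2 a‖⁻¹)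
    + ((q 1 * p 2 - q 2 * p 1) ^ 2 + (q 2 * p 0 - q 0 * p 2) ^ 2 + (q 0 * p 1 - q 1 * p 0) ^ 2
      - a ^ 2 * (p 0 ^ 2 + p 1 ^ 2)) / 2
    + a * μ1 * (q 2 + a) * ‖q - ctr1 a‖⁻¹ - a * μ2 * (q 2 - a) * ‖q - ctr2 a‖⁻¹ := by
  unfold eulerG eulerH eulerV
  rw [nsq p, nsq (cross3 q p)]
  simp only [cross3, vec3_0, vec3_1, vec3_2]
  ring

lemma derivG (a μ1 μ2 : ℝ) (t : ℝ) (q p : ℝ → R3)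
    (h1 : q t ≠ ctr1 a) (h2 : q t ≠ ctr2 a)
    (hq : HasDerivAt q (p t) t)
    (hp : HasDerivAt p (-gradient (eulerV a μ1 μ2) (q t)) t) :
    HasDerivAt (fun s => eulerG a μ1 μ2 (q s) (p s)) 0 t := by
  simp only [G_eq]
  rw [gradV a μ1 μ2 _ h1 h2] at hp
  have q0 := coordD q _ t hq 0
  have q1 := coordD q _ t hq 1
  have q2 := coordD q _ t hq 2
  have p0 := coordD p _ t hp 0
  have p1 := coordD p _ t hp 1
  have p2 := coordD p _ t hp 2
  have i1 := curve_inv q _ _ t hq h1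
  have i2 := curve_inv q _ _ t hq h2
  have n1 : ‖q t - ctr1 a‖ ≠ 0 := norm_ne_zero_iff.2 (sub_ne_zero.2 h1)
  have n2 : ‖q t - ctr2 a‖ ≠ 0 := norm_ne_zero_iff.2 (sub_ne_zero.2 h2)
  have s1 := nsq (q t - ctr1 a)
  have s2 := nsq (q t - ctr2 a)
  have D := ((((((p0.pow 2).add (p1.pow 2)).add (p2.pow 2)).div_const 2).add
    ((i1.const_mul (-μ1)).sub (i2.const_mul μ2))).add
    ((((((q1.mul p2).sub (q2.mul p1)).pow 2).add (((q2.mul p0).sub (q0.mul p2)).pow 2)).add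
      (((q0.mul p1).sub (q1.mul p0)).pow 2)).sub
      (((p0.pow 2).add (p1.pow 2)).const_mul (a ^ 2)) |>.div_const 2)).add
    (((q2.add_const a).const_mul (a * μ1)).mul i1) |>.sub
    (((q2.sub_const a).const_mul (a * μ2)).mul i2)
  refine D.congr_deriv ?_
  have r1 : ‖q t - ctr1 a‖⁻¹ = (‖q t - ctr1 a‖ ^ 3)⁻¹ * ‖q t - ctr1 a‖ ^ 2 := by field_simp
  have r2 : ‖q t - ctr2 a‖⁻¹ = (‖q t - ctr2 a‖ ^ 3)⁻¹ * ‖q t - ctr2 a‖ ^ 2 := by field_simp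
  rw [r1, r2, s1, s2]
  generalize (‖q t - ctr1 a‖ ^ 3)⁻¹ = A
  generalize (‖q t - ctr2 a‖ ^ 3)⁻¹ = B
  simp [ctr1, ctr2]
  ring

/-- Conservation of the separation constant `G` along solutions of the
Euler two-center problem: `G` is a first integral. -/
theorem statement1 (a μ1 μ2 : ℝ) (ha : 0 < a) (t₁ t₂ : ℝ) (q p : ℝ → R3)
    (hcent : ∀ t ∈ Set.Ioo t₁ t₂, q t ≠ ctr1 a ∧ q t ≠ ctr2 a)
    (hq : ∀ t ∈ Set.Ioo t₁ t₂, HasDerivAt q (p t) t)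
    (hp : ∀ t ∈ Set.Ioo t₁ t₂, HasDerivAt p (-gradient (eulerV a μ1 μ2) (q t)) t) :
    ∀ s ∈ Set.Ioo t₁ t₂, ∀ t ∈ Set.Ioo t₁ t₂,
      eulerG a μ1 μ2 (q s) (p s) = eulerG a μ1 μ2 (q t) (p t) := by
  have hd : ∀ t ∈ Set.Ioo t₁ t₂, HasDerivAt (fun s => eulerG a μ1 μ2 (q s) (p s)) 0 t :=
    fun t ht => derivG a μ1 μ2 t q p (hcent t ht).1 (hcent t ht).2 (hq t ht) (hp t ht)
  intro s hs t ht
  exact isOpen_Ioo.is_const_of_deriv_eq_zero isPreconnected_Ioo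
    (fun x hx => (hd x hx).differentiableAt.differentiableWithinAt)
    (fun x hx => (hd x hx).deriv) hs ht
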